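/- For a weakly C(4) finite monoid presentation ⟨A | R⟩: let u and v be words and p₁, p₂, …, p_k be pieces. Suppose there exist words u = u₁, u₂, …, u_n = v such that for each 1 ≤ i < n there exists 1 ≤ jᵢ ≤ k with p_{jᵢ}·uᵢ ≡ p_{jᵢ}·u_{i+1}. Then p_j·u ≡ p_j·v for some j with 1 ≤ j ≤ k. -/

import Mathlib

open List

/-- A *relation word* is a word occurring as one side of some relation in `R`. -/
def RelWord {A : Type*} (R : Finset (List A × List A)) (w : List A) : Prop :=
  ∃ p ∈ R, w = p.1 ∨ w = p.2

/-- One elementary rewriting step using a defining relation (in either direction). -/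
def OneStep {A : Type*} (R : Finset (List A × List A)) (u v : List A) : Prop :=
  ∃ l r x y, ((x, y) ∈ R ∨ (y, x) ∈ R) ∧ u = l ++ x ++ r ∧ v = l ++ y ++ r

/-- `u ≡ v`: the congruence on the free monoid `A*` generated by the relations `R`. -/
def MEquiv {A : Type*} (R : Finset (List A × List A)) : List A → List A → Prop :=
  Relation.ReflTransGen (OneStep R)

/-- A *piece*: a word occurring as a factor of two distinct relation words, or in two
different (possibly overlapping) positions within one relation word.  The empty word
is a piece. -/
def Piece {A : Type*} (R : Finset (List A × List A)) (p : List A) : Prop :=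
  p = [] ∨ ∃ r₁ r₂ a₁ b₁ a₂ b₂, RelWord R r₁ ∧ RelWord R r₂ ∧
    r₁ = a₁ ++ p ++ b₁ ∧ r₂ = a₂ ++ p ++ b₂ ∧ (r₁ ≠ r₂ ∨ a₁ ≠ a₂)

/-- Weakly `C(n)`: no relation word is a product of strictly fewer than `n` pieces. -/
def WeaklyC {A : Type*} (R : Finset (List A × List A)) (n : ℕ) : Prop :=
  ∀ w, RelWord R w → ∀ L : List (List A), (∀ p ∈ L, Piece R p) → w = L.flatten →
    n ≤ L.length

/-- `X` is the maximal (longest) prefix of `r` which is a piece. -/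
def MaxPiecePrefix {A : Type*} (R : Finset (List A × List A)) (r X : List A) : Prop :=
  X <+: r ∧ Piece R X ∧ ∀ p, p <+: r → Piece R p → p.length ≤ X.length

/-- `Z` is the maximal (longest) suffix of `r` which is a piece. -/
def MaxPieceSuffix {A : Type*} (R : Finset (List A × List A)) (r Z : List A) : Prop :=
  Z <:+ r ∧ Piece R Z ∧ ∀ s, s <:+ r → Piece R s → s.length ≤ Z.length

/-- `X ++ Y ++ Z` is a relation word with maximal piece prefix `X`, middle word `Y`
and maximal piece suffix `Z`. -/
def RelDecomp {A : Type*} (R : Finset (List A × List A)) (X Y Z : List A) : Prop :=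
  RelWord R (X ++ Y ++ Z) ∧ MaxPiecePrefix R (X ++ Y ++ Z) X ∧
    MaxPieceSuffix R (X ++ Y ++ Z) Z

/-- `q` is a relation prefix of `u`: a prefix of the form `a ++ X ++ Y` where `X`, `Y`
are the maximal piece prefix and middle word of some relation word `X ++ Y ++ Z`. -/
def RelPrefix {A : Type*} (R : Finset (List A × List A)) (u q : List A) : Prop :=
  q <+: u ∧ ∃ a X Y Z, q = a ++ X ++ Y ∧ RelDecomp R X Y Z

/-- `a ++ X ++ Y` is an overlap prefix of `u`, with final maximal piece prefix `X` and
middle word `Y`, i.e. it admits a factorisation `b X₁ Y₁' ⋯ X_{n-1} Y_{n-1}' X_n Y_n`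
with `X = X_n`, `Y = Y_n`, no factor `X₀ Y₀` beginning strictly before the end of `b`,
each `X_i Y_i Z_i` a relation word factored into maximal piece prefix, middle word and
maximal piece suffix, and each `Y_i'` (`i < n`) a proper non-empty prefix of `Y_i`. -/
def OPrefix {A : Type*} (R : Finset (List A × List A)) (u a X Y : List A) : Prop :=
  (a ++ X ++ Y) <+: u ∧
  ∃ (b : List A) (n : ℕ) (Xs Ys Zs Ys' : ℕ → List A),
    1 ≤ n ∧ Xs (n - 1) = X ∧ Ys (n - 1) = Y ∧
    a = b ++ ((List.range (n - 1)).map fun i => Xs i ++ Ys' i).flatten ∧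
    (∀ i < n, RelDecomp R (Xs i) (Ys i) (Zs i)) ∧
    (∀ i < n - 1, Ys' i ≠ [] ∧ Ys' i <+: Ys i ∧ Ys' i ≠ Ys i) ∧
    ¬ ∃ c d X₀ Y₀ Z₀, RelDecomp R X₀ Y₀ Z₀ ∧
        a ++ X ++ Y = c ++ X₀ ++ Y₀ ++ d ∧ c.length < b.length

/-- The relation prefix `a ++ X ++ Y` of `u` is *clean*: `u` has no prefix
`a ++ X ++ Y₀ ++ X₁ ++ Y₁` with `Y₀` a proper non-empty prefix of `Y` and `X₁`, `Y₁`
the maximal piece prefix and middle word of some relation word. -/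
def CleanAt {A : Type*} (R : Finset (List A × List A)) (u a X Y : List A) : Prop :=
  ¬ ∃ Y₀ X₁ Y₁ Z₁, RelDecomp R X₁ Y₁ Z₁ ∧ Y₀ ≠ [] ∧ Y₀ <+: Y ∧ Y₀ ≠ Y ∧
      (a ++ X ++ Y₀ ++ X₁ ++ Y₁) <+: u

/-- `a ++ X ++ Y` is a clean overlap prefix of `u`, where `X ++ Y ++ Z` is a relation
word with maximal piece prefix `X`, middle word `Y` and maximal piece suffix `Z`. -/
def CleanOverlapPrefix {A : Type*} (R : Finset (List A × List A))
    (u a X Y Z : List A) : Prop :=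
  RelDecomp R X Y Z ∧ OPrefix R u a X Y ∧ CleanAt R u a X Y

/-- `r'` is a complement of the relation word `r`: there is a chain of relation words
from `r` to `r'` each consecutive pair of which forms a relation (in some order). -/
def RelComplement {A : Type*} (R : Finset (List A × List A)) (r r' : List A) : Prop :=
  RelWord R r ∧ Relation.ReflTransGen (fun s t => (s, t) ∈ R ∨ (t, s) ∈ R) r r'

/-- `u` is `p`-active: `p ++ u` has a relation prefix `a ++ X ++ Y` with `|a| < |p|`. -/
def PActive {A : Type*} (R : Finset (List A × List A)) (p u : List A) : Prop :=
  ∃ a X Y Z, RelDecomp R X Y Z ∧ (a ++ X ++ Y) <+: (p ++ u) ∧ a.length < p.length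

/-- `p` is a possible prefix of `u`: `p ++ w ≡ u` for some word `w`. -/
def PossPrefix {A : Type*} (R : Finset (List A × List A)) (p u : List A) : Prop :=
  ∃ w, MEquiv R (p ++ w) u

section SmallOverlap

variable {A : Type*} {R : Finset (List A × List A)}

theorem append_eq_append_cases {a b c d : List A} (h : a ++ b = c ++ d) :
    (∃ e, c = a ++ e ∧ b = e ++ d) ∨ (∃ e, e ≠ [] ∧ a = c ++ e ∧ d = e ++ b) := by
  rcases List.append_eq_append_iff.1 h with ⟨e, h1, h2⟩ | ⟨e, h1, h2⟩
  · exact Or.inl ⟨e, h1, h2⟩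
  · by_cases he : e = []
    · subst he
      exact Or.inl ⟨[], by simp_all, by simp_all⟩
    · exact Or.inr ⟨e, he, h1, h2⟩

/-! ### The congruence -/

theorem OneStep.symm {u v : List A} (h : OneStep R u v) : OneStep R v u := by
  obtain ⟨l, r, x, y, h, rfl, rfl⟩ := h
  exact ⟨l, r, y, x, h.symm, rfl, rfl⟩

theorem OneStep.append_left {u v : List A} (c : List A) (h : OneStep R u v) :
    OneStep R (c ++ u) (c ++ v) := by
  obtain ⟨l, r, x, y, h, rfl, rfl⟩ := h
  exact ⟨c ++ l, r, x, y, h, by simp, by simp⟩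

theorem MEquiv.symm {u v : List A} (h : MEquiv R u v) : MEquiv R v u := by
  induction h with
  | refl => exact .refl
  | tail _ hs ih => exact Relation.ReflTransGen.head hs.symm ih

theorem MEquiv.trans {u v w : List A} (h : MEquiv R u v) (h' : MEquiv R v w) : MEquiv R u w :=
  Relation.ReflTransGen.trans h h'

theorem MEquiv.append_left {u v : List A} (c : List A) (h : MEquiv R u v) :
    MEquiv R (c ++ u) (c ++ v) := by
  induction h with
  | refl => exact .refl
  | tail _ hs ih => exact ih.tail (hs.append_left c)

theorem RelWord.of_rel {x y : List A} (h : (x, y) ∈ R ∨ (y, x) ∈ R) :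
    RelWord R x ∧ RelWord R y := by
  rcases h with h | h
  · exact ⟨⟨_, h, Or.inl rfl⟩, ⟨_, h, Or.inr rfl⟩⟩
  · exact ⟨⟨_, h, Or.inr rfl⟩, ⟨_, h, Or.inl rfl⟩⟩

/-- `DerivN R n u v`: at most `n` elementary rewriting steps lead from `u` to `v`. -/
inductive DerivN (R : Finset (List A × List A)) : ℕ → List A → List A → Prop
  | refl (n : ℕ) (u : List A) : DerivN R n u u
  | tail {n : ℕ} {u v w : List A} : DerivN R n u v → OneStep R v w → DerivN R (n + 1) u w

theorem DerivN.mEquiv {n : ℕ} {u v : List A} (h : DerivN R n u v) : MEquiv R u v := by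
  induction h with
  | refl => exact .refl
  | tail _ hs ih => exact ih.tail hs

theorem MEquiv.exists_derivN {u v : List A} (h : MEquiv R u v) : ∃ n, DerivN R n u v := by
  induction h with
  | refl => exact ⟨0, .refl 0 _⟩
  | tail _ hs ih =>
    obtain ⟨n, hn⟩ := ih
    exact ⟨n + 1, hn.tail hs⟩

theorem DerivN.append_left {n : ℕ} {u v : List A} (c : List A) (h : DerivN R n u v) :
    DerivN R n (c ++ u) (c ++ v) := by
  induction h with
  | refl => exact .refl _ _
  | tail _ hs ih => exact ih.tail (hs.append_left c)

/-! ### Pieces -/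

theorem Piece.of_two_occurrences {r₁ r₂ a₁ p b₁ a₂ b₂ : List A} (h₁ : RelWord R r₁)
    (h₂ : RelWord R r₂) (e₁ : r₁ = a₁ ++ p ++ b₁) (e₂ : r₂ = a₂ ++ p ++ b₂)
    (h : r₁ ≠ r₂ ∨ a₁ ≠ a₂) : Piece R p :=
  Or.inr ⟨r₁, r₂, a₁, b₁, a₂, b₂, h₁, h₂, e₁, e₂, h⟩

theorem Piece.factor {a p b : List A} (h : Piece R (a ++ p ++ b)) : Piece R p := by
  rcases h with h | ⟨r₁, r₂, a₁, b₁, a₂, b₂, h₁, h₂, e₁, e₂, h⟩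
  · left
    simp_all
  · refine Piece.of_two_occurrences (a₁ := a₁ ++ a) (b₁ := b ++ b₁) (a₂ := a₂ ++ a)
      (b₂ := b ++ b₂) h₁ h₂ (by simp [e₁]) (by simp [e₂]) ?_
    simpa using h

theorem Piece.left {p b : List A} (h : Piece R (p ++ b)) : Piece R p :=
  Piece.factor (a := []) (b := b) h

theorem Piece.right {a p : List A} (h : Piece R (a ++ p)) : Piece R p :=
  Piece.factor (a := a) (b := []) (by simpa using h)

theorem WeaklyC.not_relWord (hC : WeaklyC R 4) {p : List A} (hp : Piece R p) : ¬ RelWord R p :=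
  fun h => by simpa using hC p h [p] (by simpa using hp) (by simp)

theorem WeaklyC.not_relWord_append (hC : WeaklyC R 4) {p q : List A} (hp : Piece R p)
    (hq : Piece R q) : ¬ RelWord R (p ++ q) :=
  fun h => by simpa using hC _ h [p, q] (by simp [hp, hq]) (by simp)

theorem WeaklyC.not_relWord_append_append (hC : WeaklyC R 4) {p q s : List A} (hp : Piece R p)
    (hq : Piece R q) (hs : Piece R s) : ¬ RelWord R (p ++ q ++ s) :=
  fun h => by simpa using hC _ h [p, q, s] (by simp [hp, hq, hs]) (by simp)

/-- `P ++ Z` is a relation word with maximal piece suffix `Z`. -/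
structure SuffixDecomp (R : Finset (List A × List A)) (P Z : List A) : Prop where
  relWord : RelWord R (P ++ Z)
  piece : Piece R Z
  maximal : ∀ e f, P = e ++ f → f ≠ [] → ¬ Piece R (f ++ Z)

theorem RelWord.exists_suffixDecomp {r : List A} (hr : RelWord R r) :
    ∃ P Z, r = P ++ Z ∧ SuffixDecomp R P Z := by
  classical
  have hex : ∃ k, Piece R (r.drop k) := ⟨r.length, by simp [Piece]⟩
  refine ⟨r.take (Nat.find hex), r.drop (Nat.find hex), by simp, by simpa using hr,
    Nat.find_spec hex, ?_⟩
  intro e f hef hf hpiece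
  have hlen := congrArg List.length hef
  have hfpos := List.length_pos_iff.2 hf
  simp only [List.length_take, List.length_append] at hlen
  refine Nat.find_min hex (m := e.length) (by omega) ?_
  have hr' : r = e ++ (f ++ r.drop (Nat.find hex)) := by
    rw [← List.append_assoc, ← hef, List.take_append_drop]
  have hd : r.drop e.length = f ++ r.drop (Nat.find hex) := by
    conv_lhs => rw [hr']
    simp
  rwa [hd]

theorem SuffixDecomp.not_piece (hC : WeaklyC R 4) {P Z : List A} (h : SuffixDecomp R P Z) :
    ¬ Piece R P :=
  fun hP => hC.not_relWord_append hP h.piece h.relWord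

/-! ### Relation words crossing a boundary -/

/-- Some occurrence of a relation word in `c ++ w` starts inside `c`. -/
def StartsIn (R : Finset (List A × List A)) (c w : List A) : Prop :=
  ∃ a f ρ b, c = a ++ f ∧ f ≠ [] ∧ RelWord R ρ ∧ f ++ w = ρ ++ b

/-- No relation word starts inside `c` when `c` is followed by a piece. -/
def Blocks (R : Finset (List A × List A)) (c : List A) : Prop :=
  ∀ x, Piece R x → ¬ StartsIn R c x

theorem blocks_of_piece_overlaps (hC : WeaklyC R 4) {c : List A}
    (H : ∀ a g b b', c = a ++ g ++ b → RelWord R (g ++ b') → Piece R g) : Blocks R c := by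
  rintro x hx ⟨a, f, ρ, b, hc, -, hρ, h⟩
  rcases append_eq_append_cases h with ⟨e, rfl, rfl⟩ | ⟨e, -, rfl, -⟩
  · exact hC.not_relWord_append (H a f [] e (by simpa using hc) hρ) hx.left hρ
  · exact hC.not_relWord (H a ρ e [] (by simpa using hc) (by simpa using hρ)) hρ

theorem Piece.blocks (hC : WeaklyC R 4) {p : List A} (hp : Piece R p) : Blocks R p :=
  blocks_of_piece_overlaps hC fun _ _ _ _ h _ => (h ▸ hp).factor

theorem RelWord.blocks_factor (hC : WeaklyC R 4) {a c b : List A} (h : RelWord R (a ++ c ++ b))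
    (ha : a ≠ []) : Blocks R c := by
  refine blocks_of_piece_overlaps hC ?_
  rintro a' g b₁ b' rfl hg
  exact Piece.of_two_occurrences (a₁ := a ++ a') (b₁ := b₁ ++ b) (a₂ := []) (b₂ := b') h hg
    (by simp) (by simp) (Or.inr (by simp [ha]))

theorem Blocks.not_startsIn (hC : WeaklyC R 4) {c P Z : List A} (hc : Blocks R c)
    (hP : SuffixDecomp R P Z) (t : List A) : ¬ StartsIn R c (P ++ t) := by
  rintro ⟨a, f, ρ, b, rfl, hf, hρ, h⟩
  rcases append_eq_append_cases h with ⟨e, rfl, he⟩ | ⟨e, he, rfl, -⟩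
  · rcases append_eq_append_cases he with ⟨y, rfl, -⟩ | ⟨y, -, rfl, -⟩
    · exact hP.not_piece hC (Piece.of_two_occurrences (a₁ := f) (b₁ := y) (a₂ := []) (b₂ := Z)
        hρ hP.relWord (by simp) (by simp) (Or.inr hf))
    · have hpe : Piece R e := Piece.of_two_occurrences (a₁ := f) (b₁ := []) (a₂ := [])
        (b₂ := y ++ Z) hρ hP.relWord (by simp) (by simp) (Or.inr hf)
      exact hc e hpe ⟨a, f, f ++ e, [], rfl, hf, hρ, by simp⟩
  · exact hc [] (Or.inl rfl) ⟨a, ρ ++ e, ρ, e, rfl, hf, hρ, by simp⟩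

/-- A derivation starting from `p ++ u`, with `p` a piece, either leaves `p` alone or at
some point applies a relation word starting inside `p`. -/
theorem DerivN.cross (hC : WeaklyC R 4) {n : ℕ} {p u g : List A} (hp : Piece R p)
    (h : DerivN R n (p ++ u) g) :
    (∃ u', g = p ++ u' ∧ MEquiv R u u') ∨
    ∃ p₁ p₂ r s, p = p₁ ++ p₂ ∧ p₂ ≠ [] ∧ RelWord R (p₂ ++ r) ∧ MEquiv R u (r ++ s) ∧
      DerivN R n (p₁ ++ (p₂ ++ r) ++ s) g := by
  generalize hw : p ++ u = w at h
  induction h with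
  | refl => exact Or.inl ⟨u, hw.symm, .refl⟩
  | tail _ hs ih =>
    rcases ih hw with ⟨u', rfl, hu⟩ | ⟨p₁, p₂, r, s, h1, h2, h3, h4, h5⟩
    · obtain ⟨l, q, x, y, hxy, he, rfl⟩ := hs
      rw [List.append_assoc] at he
      rcases append_eq_append_cases he with ⟨l', rfl, rfl⟩ | ⟨e, hne, rfl, he'⟩
      · exact Or.inl ⟨l' ++ y ++ q, by simp, hu.tail ⟨l', q, x, y, hxy, by simp, rfl⟩⟩
      · rcases append_eq_append_cases he' with ⟨z, rfl, rfl⟩ | ⟨z, -, rfl, rfl⟩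
        · exact absurd (RelWord.of_rel hxy).1 (hC.not_relWord hp.right.left)
        · exact Or.inr ⟨l, e, z, q, rfl, hne, (RelWord.of_rel hxy).1, hu,
            (DerivN.refl _ _).tail ⟨l, q, _, y, hxy, rfl, rfl⟩⟩
    · exact Or.inr ⟨p₁, p₂, r, s, h1, h2, h3, h4, h5.tail hs⟩

/-! ### Stability of prefixes under derivations -/

/-- If `c` blocks relation words, then derivations of length at most `n` from a word
`c ++ r ++ s` with `r` a relation word leave `c` alone. -/
def StableAt (R : Finset (List A × List A)) (n : ℕ) : Prop :=
  ∀ c r s g, Blocks R c → RelWord R r → DerivN R n (c ++ r ++ s) g →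
    ∃ P Z t s', SuffixDecomp R P Z ∧ g = c ++ (P ++ t) ∧ DerivN R n (Z ++ s') t ∧
      MEquiv R (r ++ s) (P ++ t)

theorem StableAt.not_startsIn (hC : WeaklyC R 4) {n : ℕ} (hn : StableAt R n)
    {r₁ r₂ Z s t : List A} (hP : SuffixDecomp R (r₁ ++ r₂) Z) (h₁ : r₁ ≠ [])
    (h : DerivN R n (Z ++ s) t) : ¬ StartsIn R r₂ t := by
  rcases h.cross hC hP.piece with ⟨s', rfl, -⟩ | ⟨z₁, z₂, r, s', rfl, hz, hr, -, hd⟩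
  · rintro ⟨a, f, ρ, b, rfl, hf, hρ, he⟩
    rw [← List.append_assoc] at he
    have hPZ := hP.relWord
    rcases append_eq_append_cases he with ⟨y, rfl, -⟩ | ⟨y, -, hy, -⟩
    · exact hP.maximal (r₁ ++ a) f (by simp) hf
        (Piece.of_two_occurrences (a₁ := r₁ ++ a) (b₁ := []) (a₂ := []) (b₂ := y)
          hPZ hρ (by simp) (by simp) (Or.inr (by simp [h₁])))
    · refine hC.not_relWord (Piece.of_two_occurrences (a₁ := r₁ ++ a) (b₁ := y) (a₂ := [])
        (b₂ := []) hPZ hρ ?_ (by simp) (Or.inr (by simp [h₁]))) hρ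
      simp [← hy]
  · have hb : Blocks R (r₂ ++ z₁) := RelWord.blocks_factor hC (a := r₁) (b := z₂)
      (by simpa using hP.relWord) h₁
    have hd' := hd.append_left r₂
    obtain ⟨P, Z', t', s'', hP', he, -, -⟩ := hn (r₂ ++ z₁) (z₂ ++ r) s' (r₂ ++ t) hb hr
      (by simpa using hd')
    have ht : t = z₁ ++ (P ++ t') := by simpa using he
    subst ht
    rintro ⟨a, f, ρ, b, rfl, hf, hρ, he'⟩
    exact hb.not_startsIn hC hP' t'
      ⟨a, f ++ z₁, ρ, b, by simp, by simp [hf], hρ, by simpa using he'⟩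

theorem stableAt (hC : WeaklyC R 4) (n : ℕ) : StableAt R n := by
  induction n with
  | zero =>
    intro c r s g _ hr h
    cases h
    obtain ⟨P, Z, rfl, hP⟩ := hr.exists_suffixDecomp
    exact ⟨P, Z, Z ++ s, s, hP, by simp, .refl _ _, by simpa using .refl⟩
  | succ n ih =>
    intro c r s g hc hr h
    cases h with
    | refl =>
      obtain ⟨P, Z, rfl, hP⟩ := hr.exists_suffixDecomp
      exact ⟨P, Z, Z ++ s, s, hP, by simp, .refl _ _, by simpa using .refl⟩
    | tail h hs =>
      obtain ⟨P, Z, t, s', hP, rfl, hd, hm⟩ := ih c r s _ hc hr h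
      obtain ⟨l, q, x, y, hxy, he, rfl⟩ := hs
      obtain ⟨hx, hy⟩ := RelWord.of_rel hxy
      rw [List.append_assoc] at he
      rcases append_eq_append_cases he with ⟨l', rfl, hl'⟩ | ⟨f, hf, rfl, he'⟩
      · have hm' : MEquiv R (r ++ s) (l' ++ y ++ q) :=
          hm.tail ⟨l', q, x, y, hxy, by simpa using hl', rfl⟩
        rcases append_eq_append_cases hl' with ⟨l'', rfl, rfl⟩ | ⟨f, hf, rfl, he'⟩
        · exact ⟨P, Z, l'' ++ y ++ q, s', hP, by simp,
            hd.tail ⟨l'', q, x, y, hxy, by simp, rfl⟩, by simpa using hm'⟩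
        · by_cases hl : l' = []
          · subst hl
            obtain ⟨P', Z', rfl, hP'⟩ := hy.exists_suffixDecomp
            exact ⟨P', Z', Z' ++ q, q, hP', by simp, .refl _ _, by simpa using hm'⟩
          · exact absurd ⟨[], f, x, q, rfl, hf, hx, he'.symm⟩
              (ih.not_startsIn hC hP hl hd)
      · exact absurd ⟨l, f, x, q, rfl, hf, hx, he'.symm⟩ (hc.not_startsIn hC hP t)

theorem MEquiv.stable (hC : WeaklyC R 4) {c r s g : List A} (hc : Blocks R c)
    (hr : RelWord R r) (h : MEquiv R (c ++ r ++ s) g) :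
    ∃ h', g = c ++ h' ∧ MEquiv R (r ++ s) h' := by
  obtain ⟨n, hn⟩ := h.exists_derivN
  obtain ⟨P, Z, t, s', -, rfl, -, hm⟩ := stableAt hC n c r s g hc hr hn
  exact ⟨P ++ t, rfl, hm⟩

/-- If `r₁ ++ r₂` is a relation word without its maximal piece suffix `Z` and `r₁` is
nonempty, then every word equivalent to `r₂ ++ Z ++ s` begins with `r₂`. -/
theorem SuffixDecomp.exists_eq_append (hC : WeaklyC R 4) {r₁ r₂ Z s g : List A}
    (hP : SuffixDecomp R (r₁ ++ r₂) Z) (h₁ : r₁ ≠ []) (h : MEquiv R (r₂ ++ Z ++ s) g) :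
    ∃ t, g = r₂ ++ t := by
  obtain ⟨n, hn⟩ := h.exists_derivN
  suffices ∃ t, g = r₂ ++ t ∧ DerivN R n (Z ++ s) t from this.imp fun _ h => h.1
  clear h
  generalize hw : r₂ ++ Z ++ s = w at hn
  induction hn with
  | refl => exact ⟨Z ++ s, by simp [← hw], .refl _ _⟩
  | tail _ hs ih =>
    obtain ⟨t, rfl, ht⟩ := ih hw
    obtain ⟨l, q, x, y, hxy, he, rfl⟩ := hs
    rw [List.append_assoc] at he
    rcases append_eq_append_cases he with ⟨l', rfl, rfl⟩ | ⟨f, hf, rfl, he'⟩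
    · exact ⟨l' ++ y ++ q, by simp, ht.tail ⟨l', q, x, y, hxy, by simp, rfl⟩⟩
    · exact absurd ⟨l, f, x, q, rfl, hf, (RelWord.of_rel hxy).1, he'.symm⟩
        ((stableAt hC _).not_startsIn hC hP h₁ ht)

/-! ### Pieces acting on equivalent words -/

/-- A piece `p` identifying `u` and `v` without these being equivalent does so through a
nonempty suffix of `p` that is completed to a relation word by a prefix of a word
equivalent to `u`. -/
theorem MEquiv.exists_active_suffix (hC : WeaklyC R 4) {p u v : List A} (hp : Piece R p)
    (h : MEquiv R (p ++ u) (p ++ v)) :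
    MEquiv R u v ∨ ∃ p₁ p₂ P Z s, p = p₁ ++ p₂ ∧ p₂ ≠ [] ∧ SuffixDecomp R (p₂ ++ P) Z ∧
      MEquiv R u (P ++ Z ++ s) ∧ MEquiv R (p₂ ++ u) (p₂ ++ v) := by
  obtain ⟨n, hn⟩ := h.exists_derivN
  rcases hn.cross hC hp with ⟨u', hu', hm⟩ | ⟨p₁, p₂, r, s, rfl, hne, hr, hm, hd⟩
  · rw [List.append_cancel_left hu']
    exact Or.inl hm
  · right
    obtain ⟨h', he, hm'⟩ := hd.mEquiv.stable hC (hp.left.blocks hC) hr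
    have hh' : h' = p₂ ++ v := by
      rw [List.append_assoc] at he
      exact (List.append_cancel_left he).symm
    subst hh'
    obtain ⟨Q, Z, hQ, hdec⟩ := hr.exists_suffixDecomp
    have hbase : MEquiv R (p₂ ++ u) (p₂ ++ v) :=
      (hm.append_left p₂).trans (by simpa using hm')
    rcases append_eq_append_cases hQ with ⟨P, rfl, rfl⟩ | ⟨e, -, rfl, -⟩
    · exact ⟨p₁, p₂, P, Z, s, rfl, hne, hdec, hm, hbase⟩
    · exact absurd hp.right.left (hdec.not_piece hC)

/-- Two occurrences of relation words whose parts `P`, `P'` begin the same word coincide. -/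
theorem SuffixDecomp.left_eq_of_append_eq (hC : WeaklyC R 4) {a P Z b P' Z' t t' : List A}
    (ha : Piece R a) (h : SuffixDecomp R (a ++ P) Z) (h' : SuffixDecomp R (b ++ P') Z')
    (hle : P.length ≤ P'.length) (he : P ++ t = P' ++ t') : a = b := by
  obtain ⟨e, rfl⟩ := List.prefix_of_prefix_length_le (List.prefix_append P t)
    (he ▸ List.prefix_append P' t') hle
  by_contra hne
  refine hC.not_relWord_append_append ha ?_ h.piece h.relWord
  exact Piece.of_two_occurrences (a₁ := a) (b₁ := Z) (a₂ := b) (b₂ := e ++ Z')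
    h.relWord h'.relWord rfl (by simp) (Or.inr hne)

theorem MEquiv.piece_trans (hC : WeaklyC R 4) {p q u v w : List A} (hp : Piece R p)
    (hq : Piece R q) (huv : MEquiv R (p ++ u) (p ++ v)) (hvw : MEquiv R (q ++ v) (q ++ w)) :
    MEquiv R (p ++ u) (p ++ w) ∨ MEquiv R (q ++ u) (q ++ w) := by
  rcases huv.symm.exists_active_suffix hC hp with h | ⟨p₁, a, P, Z, s, rfl, ha, hP, hv, hpa⟩
  · exact Or.inr ((h.symm.append_left q).trans hvw)
  rcases hvw.exists_active_suffix hC hq with h | ⟨q₁, b, P', Z', s', rfl, hb, hP', hv', hqb⟩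
  · exact Or.inl (huv.trans (h.append_left _))
  obtain ⟨t, ht⟩ := hP.exists_eq_append hC ha (hv.symm.trans hv')
  have hab : a = b := by
    rw [List.append_assoc] at ht
    rcases le_total P.length P'.length with hle | hle
    · exact hP.left_eq_of_append_eq hC hp.right hP' hle ht.symm
    · exact (hP'.left_eq_of_append_eq hC hq.right hP hle ht).symm
  subst hab
  left
  rw [List.append_assoc, List.append_assoc]
  exact (hpa.symm.trans hqb).append_left p₁

end SmallOverlap

/-- Corollary 11: for a weakly `C(4)` finite monoid presentation,
let `u = us 0, us 1, …, us (n-1) = v` be a sequence of words and `p 0, …, p (k-1)`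
pieces such that each consecutive pair `us i`, `us (i+1)` satisfies
`p j ++ us i ≡ p j ++ us (i+1)` for some `j < k`.  Then `p j ++ u ≡ p j ++ v` for
some `j < k`. -/
theorem either_or {A : Type*} [Fintype A] [DecidableEq A]
    (R : Finset (List A × List A)) (hC : WeaklyC R 4)
    (k n : ℕ) (hk : 1 ≤ k) (hn : 1 ≤ n)
    (p : ℕ → List A) (hp : ∀ j < k, Piece R (p j))
    (us : ℕ → List A)
    (hstep : ∀ i, i + 1 < n → ∃ j < k, MEquiv R (p j ++ us i) (p j ++ us (i + 1))) :
    ∃ j < k, MEquiv R (p j ++ us 0) (p j ++ us (n - 1)) := by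
  have key : ∀ m, m < n → ∃ j < k, MEquiv R (p j ++ us 0) (p j ++ us m) := by
    intro m
    induction m with
    | zero => exact fun _ => ⟨0, hk, .refl⟩
    | succ m ih =>
      intro hm
      obtain ⟨i, hi, h⟩ := ih (by omega)
      obtain ⟨j, hj, h'⟩ := hstep m hm
      rcases h.piece_trans hC (hp i hi) (hp j hj) h' with h | h
      · exact ⟨i, hi, h⟩
      · exact ⟨j, hj, h⟩
  exact key (n - 1) (by omega)
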